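/- Let c ∈ ℝ, α ≥ c²/2, α > 0. For every initial datum (p̃2*, s2*) ∈ ℝ × (-∞, 0), the characteristic system p̃2' = (1/2)(p̃2² - c²)·e^{2·s2} + α, s2' = (p̃2/2)(1 - e^{2·s2}) has a unique solution through (p̃2*, s2*), and this solution reaches the collision configuration in finite time: there exists T < ∞ such that s2(t) < 0 on [0, T), s2(t) → 0 and p̃2(t) → +∞ as t → T⁻. -/

import Mathlib

open Real Set Filter Topology

lemma mul_sub_le_sub_of_forall_hasDerivAt {f f' : ℝ → ℝ} {C a b : ℝ} (hab : a ≤ b)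
    (hf : ∀ x ∈ Icc a b, HasDerivAt f (f' x) x) (hC : ∀ x ∈ Icc a b, C ≤ f' x) :
    C * (b - a) ≤ f b - f a := by
  refine (convex_Icc a b).mul_sub_le_image_sub_of_le_deriv
    (fun x hx ↦ (hf x hx).continuousAt.continuousWithinAt) ?_ ?_ a (left_mem_Icc.2 hab) b
    (right_mem_Icc.2 hab) hab
  · intro x hx
    exact (hf x (interior_subset hx)).differentiableAt.differentiableWithinAt
  · intro x hx
    rw [(hf x (interior_subset hx)).deriv]
    exact hC x (interior_subset hx)

/-- Two solutions of an autonomous `C¹` differential equation with the same initial value agree. -/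
lemma eq_of_hasDerivAt_Ico_of_contDiff {E : Type*} [NormedAddCommGroup E] [NormedSpace ℝ E]
    [FiniteDimensional ℝ E] {F : E → E} (hF : ContDiff ℝ 1 F) {f g : ℝ → E} {a b : ℝ}
    (hf : ∀ t ∈ Ico a b, HasDerivAt f (F (f t)) t)
    (hg : ∀ t ∈ Ico a b, HasDerivAt g (F (g t)) t) (hfg : f a = g a) :
    ∀ t ∈ Ico a b, f t = g t := by
  intro t ht
  have hsub : Icc a t ⊆ Ico a b := fun x hx ↦ ⟨hx.1, hx.2.trans_lt ht.2⟩
  have hfc : ContinuousOn f (Icc a t) := fun x hx ↦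
    (hf x (hsub hx)).continuousAt.continuousWithinAt
  have hgc : ContinuousOn g (Icc a t) := fun x hx ↦
    (hg x (hsub hx)).continuousAt.continuousWithinAt
  obtain ⟨R, hR⟩ := ((isCompact_Icc.image_of_continuousOn hfc).union
    (isCompact_Icc.image_of_continuousOn hgc)).isBounded.subset_closedBall 0
  obtain ⟨K, hK⟩ := hF.contDiffOn.exists_lipschitzOnWith one_ne_zero
    (convex_closedBall (0 : E) R) (isCompact_closedBall 0 R)
  have hIco : Ico a t ⊆ Icc a t := Ico_subset_Icc_self
  exact ODE_solution_unique_of_mem_Icc_right (v := fun _ ↦ F)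
    (s := fun _ ↦ Metric.closedBall 0 R) (fun _ _ ↦ hK) hfc
    (fun x hx ↦ (hf x (hsub (hIco hx))).hasDerivWithinAt)
    (fun x hx ↦ hR (Or.inl (mem_image_of_mem f (hIco hx)))) hgc
    (fun x hx ↦ (hg x (hsub (hIco hx))).hasDerivWithinAt)
    (fun x hx ↦ hR (Or.inr (mem_image_of_mem g (hIco hx)))) hfg (right_mem_Icc.2 ht.1)

/-- A Newton equation with bounded `C¹` force has solutions on arbitrarily long time intervals. -/
lemma exists_solution_of_bounded_force {H : ℝ → ℝ} (hH : ContDiff ℝ 1 H) {B : ℝ}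
    (hB : ∀ x, |H x| ≤ B) (v₀ z₀ : ℝ) {T : ℝ} (hT : 1 ≤ T) :
    ∃ v z : ℝ → ℝ, v 0 = v₀ ∧ z 0 = z₀ ∧
      ∀ t ∈ Ioo (-T) T, HasDerivAt v (-(z t) / 2) t ∧ HasDerivAt z (H (v t)) t := by
  have hT0 : 0 < T := by linarith
  have hB0 : 0 ≤ B := (abs_nonneg _).trans (hB 0)
  -- Rescaling the position by `T` makes the vector field small compared with the radius `a`.
  set a : ℝ := B * T + |z₀| with ha
  have ha0 : 0 ≤ a := by positivity
  set F : ℝ × ℝ → ℝ × ℝ := fun x ↦ (-x.2 / (2 * T), H (T * x.1)) with hFdef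
  have hF : ContDiff ℝ 1 F := by
    refine ContDiff.prodMk ?_ (hH.comp (by fun_prop))
    exact contDiff_snd.neg.div_const _
  set x₀ : ℝ × ℝ := (v₀ / T, z₀)
  obtain ⟨K, hK⟩ := hF.contDiffOn.exists_lipschitzOnWith one_ne_zero
    (convex_closedBall x₀ a) (isCompact_closedBall x₀ a)
  have hbound : ∀ x ∈ Metric.closedBall x₀ a, ‖F x‖ ≤ a / T := by
    intro x hx
    have h2 : |x.2 - z₀| ≤ a := by
      have := (norm_snd_le (x - x₀)).trans (mem_closedBall_iff_norm.1 hx)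
      simpa using this
    have h3 : |x.2| ≤ 2 * a := by
      have h4 := abs_sub_abs_le_abs_sub x.2 z₀
      have h5 : 0 ≤ B * T := by positivity
      linarith
    refine norm_prod_le_iff.2 ⟨?_, ?_⟩
    · simp only [hFdef, Real.norm_eq_abs, abs_div, abs_neg, abs_mul, abs_of_pos hT0, abs_two]
      rw [div_le_div_iff₀ (by positivity) hT0]
      nlinarith
    · rw [Real.norm_eq_abs, le_div_iff₀ hT0]
      have := hB (T * x.1)
      have := abs_nonneg z₀
      simp only [hFdef]
      nlinarith
  have hPL : IsPicardLindelof (fun _ ↦ F) (tmin := -T) (tmax := T)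
      ⟨0, by constructor <;> linarith⟩ x₀ (.mk a ha0) 0 (.mk (a / T) (by positivity)) K := by
    refine .of_time_independent hbound hK ?_
    simp only [sub_zero, zero_sub, neg_neg, max_self, NNReal.coe_mk, NNReal.coe_zero]
    rw [div_mul_cancel₀ _ hT0.ne']
  obtain ⟨γ, hγ0, hγ⟩ := hPL.exists_eq_forall_mem_Icc_hasDerivWithinAt₀
  have hγ0' : γ 0 = x₀ := hγ0
  refine ⟨fun t ↦ T * (γ t).1, fun t ↦ (γ t).2, ?_, by simp [hγ0', x₀], fun t ht ↦ ?_⟩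
  · simp only [hγ0', x₀]
    field_simp
  · have h := (hγ t (Ioo_subset_Icc_self ht)).hasDerivAt (Icc_mem_nhds ht.1 ht.2)
    have h1 := (hasFDerivAt_fst (p := γ t)).comp_hasDerivAt t h
    have h2 := (hasFDerivAt_snd (p := γ t)).comp_hasDerivAt t h
    refine ⟨(h1.const_mul T).congr_deriv ?_, h2.congr_deriv ?_⟩
    · simp only [hFdef, ContinuousLinearMap.coe_fst']
      field_simp
    · simp [hFdef]

/-- Under an attractive monotone force a particle starting at `v₀ > 0` reaches the origin in finite
time with nonzero velocity. -/
lemma exists_solution_reaching_zero {H : ℝ → ℝ} (hH : ContDiff ℝ 1 H) {B : ℝ}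
    (hB : ∀ x, |H x| ≤ B) (hmono : Monotone H) (hpos : ∀ x, 0 < x → 0 < H x)
    {v₀ : ℝ} (hv₀ : 0 < v₀) (z₀ : ℝ) :
    ∃ T : ℝ, 0 < T ∧ ∃ v z : ℝ → ℝ, v 0 = v₀ ∧ z 0 = z₀ ∧
      (∀ t ∈ Ico 0 T, 0 < v t ∧ HasDerivAt v (-(z t) / 2) t ∧ HasDerivAt z (H (v t)) t) ∧
      Tendsto v (𝓝[<] T) (𝓝 0) ∧ ∃ l, 0 < l ∧ Tendsto z (𝓝[<] T) (𝓝 l) := by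
  have hδ : 0 < H (v₀ / 2) := hpos _ (by positivity)
  obtain ⟨t₁, ht₁⟩ : ∃ t₁, t₁ = (|z₀| + 1) / H (v₀ / 2) := ⟨_, rfl⟩
  have ht₁0 : 0 < t₁ := by rw [ht₁]; positivity
  have hδt₁ : H (v₀ / 2) * t₁ = |z₀| + 1 := by rw [ht₁]; field_simp
  obtain ⟨μ, hμ⟩ : ∃ μ, μ = min 1 (v₀ / t₁) := ⟨_, rfl⟩
  have hμ0 : 0 < μ := by rw [hμ]; positivity
  have hμ1 : μ ≤ 1 := hμ ▸ min_le_left _ _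
  have hμt₁ : μ * t₁ ≤ v₀ := (le_div_iff₀ ht₁0).1 (hμ ▸ min_le_right _ _)
  obtain ⟨d, hd⟩ : ∃ d, d = 2 * (v₀ + |z₀| / 2 * t₁) / μ := ⟨_, rfl⟩
  have hd0 : 0 < d := by rw [hd]; positivity
  have hμd : μ / 2 * d = v₀ + |z₀| / 2 * t₁ := by rw [hd]; field_simp
  obtain ⟨v, z, hv0, hz0, hsol⟩ := exists_solution_of_bounded_force hH hB v₀ z₀
    (T := t₁ + d + 1) (by linarith)
  have hdv : ∀ t ∈ Icc 0 (t₁ + d), HasDerivAt v (-(z t) / 2) t := fun t ht ↦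
    (hsol t ⟨by linarith [ht.1], by linarith [ht.2]⟩).1
  have hdz : ∀ t ∈ Icc 0 (t₁ + d), HasDerivAt z (H (v t)) t := fun t ht ↦
    (hsol t ⟨by linarith [ht.1], by linarith [ht.2]⟩).2
  have hH0 : ∀ x, 0 ≤ x → 0 ≤ H x := by
    intro x hx
    have h0 : 0 ≤ H 0 := by
      refine ge_of_tendsto ((hH.continuous.tendsto 0).mono_left
        (nhdsWithin_le_nhds (s := Ioi 0))) ?_
      filter_upwards [self_mem_nhdsWithin] with y hy using (hpos y hy).le
    exact h0.trans (hmono hx)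
  have hzmono : ∀ b ∈ Icc 0 (t₁ + d), (∀ t ∈ Icc 0 b, 0 ≤ v t) →
      ∀ r ∈ Icc 0 b, ∀ s ∈ Icc r b, z r ≤ z s := by
    intro b hb hvb r hr s hs
    have := mul_sub_le_sub_of_forall_hasDerivAt (C := 0) hs.1
      (fun x hx ↦ hdz x ⟨hr.1.trans hx.1, (hx.2.trans hs.2).trans hb.2⟩)
      (fun x hx ↦ hH0 _ (hvb x ⟨hr.1.trans hx.1, hx.2.trans hs.2⟩))
    linarith
  have hv_lower : ∀ M r s : ℝ, 0 ≤ r → r ≤ s → s ≤ t₁ + d → (∀ t ∈ Icc r s, z t ≤ M) →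
      v r - M / 2 * (s - r) ≤ v s := by
    intro M r s hr hrs hs hM
    have := mul_sub_le_sub_of_forall_hasDerivAt (C := -M / 2) hrs
      (fun x hx ↦ hdv x ⟨hr.trans hx.1, hx.2.trans hs⟩)
      (fun x hx ↦ by linarith [hM x hx])
    linarith
  have hv_upper : ∀ M r s : ℝ, 0 ≤ r → r ≤ s → s ≤ t₁ + d → (∀ t ∈ Icc r s, M ≤ z t) →
      v s ≤ v r - M / 2 * (s - r) := by
    intro M r s hr hrs hs hM
    have := mul_sub_le_sub_of_forall_hasDerivAt (C := M / 2) hrs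
      (fun x hx ↦ (hdv x ⟨hr.trans hx.1, hx.2.trans hs⟩).neg)
      (fun x hx ↦ by linarith [hM x hx])
    simp only [Pi.neg_apply] at this
    linarith
  have hreach : ∃ t ∈ Icc 0 (t₁ + d), v t ≤ 0 := by
    by_contra! hcon
    have hzm := hzmono (t₁ + d) ⟨by linarith, le_rfl⟩ (fun t ht ↦ (hcon t ht).le)
    have hzt₁ : μ ≤ z t₁ := by
      by_contra! hlt
      have hvlow : ∀ t ∈ Icc 0 t₁, v₀ / 2 ≤ v t := by
        intro t ht
        have h1 := hv_lower μ 0 t le_rfl ht.1 (by linarith [ht.2]) fun u hu ↦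
          (hzm u ⟨hu.1, by linarith [hu.2, ht.2]⟩ t₁
            ⟨hu.2.trans ht.2, by linarith⟩).trans hlt.le
        rw [hv0] at h1
        have h2 : μ * t ≤ μ * t₁ := by gcongr; exact ht.2
        linarith
      have h3 := mul_sub_le_sub_of_forall_hasDerivAt ht₁0.le
        (fun x hx ↦ hdz x ⟨hx.1, by linarith [hx.2]⟩)
        (fun x hx ↦ hmono (hvlow x hx))
      rw [hz0, sub_zero, hδt₁] at h3
      linarith [neg_abs_le z₀]
    have h4 := hv_upper (-|z₀|) 0 t₁ le_rfl ht₁0.le (by linarith) fun u hu ↦ by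
      have := hzm 0 ⟨le_rfl, by linarith⟩ u ⟨hu.1, by linarith [hu.2]⟩
      linarith [neg_abs_le z₀]
    have h5 := hv_upper μ t₁ (t₁ + d) ht₁0.le (by linarith) le_rfl fun u hu ↦
      hzt₁.trans (hzm t₁ ⟨ht₁0.le, by linarith⟩ u hu)
    have h6 := hcon (t₁ + d) ⟨by linarith, le_rfl⟩
    have h7 : t₁ + d - t₁ = d := by ring
    rw [h7, hμd] at h5
    rw [hv0] at h4
    linarith
  obtain ⟨T, ⟨hTmem, hvT⟩, hTmin⟩ : ∃ T, IsLeast {t | t ∈ Icc 0 (t₁ + d) ∧ v t ≤ 0} T := by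
    refine IsCompact.exists_isLeast ?_ hreach
    have hc : ContinuousOn v (Icc 0 (t₁ + d)) := fun x hx ↦
      (hdv x hx).continuousAt.continuousWithinAt
    exact isCompact_Icc.of_isClosed_subset
      (hc.preimage_isClosed_of_isClosed isClosed_Icc isClosed_Iic) (fun x hx ↦ hx.1)
  have hT0 : 0 < T := by
    refine hTmem.1.lt_of_ne ?_
    rintro rfl
    linarith
  have hvpos : ∀ t ∈ Ico 0 T, 0 < v t := by
    intro t ht
    by_contra! hcon
    exact (hTmin ⟨⟨ht.1, ht.2.le.trans hTmem.2⟩, hcon⟩).not_gt ht.2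
  have hvlim : Tendsto v (𝓝[<] T) (𝓝 (v T)) :=
    (hdv T hTmem).continuousAt.tendsto.mono_left nhdsWithin_le_nhds
  have hvT0 : v T = 0 := by
    refine hvT.antisymm (ge_of_tendsto hvlim ?_)
    filter_upwards [Ioo_mem_nhdsLT hT0] with t ht using (hvpos t ⟨ht.1.le, ht.2⟩).le
  have hzT : 0 < z T := by
    by_contra! hcon
    have hzm := hzmono T hTmem fun t ht ↦ by
      rcases ht.2.lt_or_eq with h | rfl
      exacts [(hvpos t ⟨ht.1, h⟩).le, hvT0.ge]
    have := hv_lower 0 0 T le_rfl hT0.le hTmem.2 fun u hu ↦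
      (hzm u hu T ⟨hu.2, le_rfl⟩).trans hcon
    linarith
  refine ⟨T, hT0, v, z, hv0, hz0, fun t ht ↦ ?_, hvT0 ▸ hvlim, z T, hzT, ?_⟩
  · have ht' : t ∈ Icc 0 (t₁ + d) := ⟨ht.1, ht.2.le.trans hTmem.2⟩
    exact ⟨hvpos t ht, hdv t ht', hdz t ht'⟩
  · exact (hdz T hTmem).continuousAt.tendsto.mono_left nhdsWithin_le_nhds

lemma hasDerivAt_tanh (x : ℝ) : HasDerivAt tanh (1 - tanh x ^ 2) x := by
  have hc : cosh x ≠ 0 := (cosh_pos x).ne'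
  have h := (hasDerivAt_sinh x).div (hasDerivAt_cosh x) hc
  have hfun : tanh = sinh / cosh := funext tanh_eq_sinh_div_cosh
  rw [hfun]
  refine h.congr_deriv ?_
  rw [Pi.div_apply]
  field_simp

lemma tanh_monotone : Monotone tanh := by
  refine monotone_of_deriv_nonneg (fun x ↦ (hasDerivAt_tanh x).differentiableAt) fun x ↦ ?_
  rw [(hasDerivAt_tanh x).deriv]
  linarith [tanh_sq_lt_one x]

lemma tanh_pos_of_pos {x : ℝ} (hx : 0 < x) : 0 < tanh x := by
  rw [tanh_eq_sinh_div_cosh]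
  exact div_pos (sinh_pos_iff.2 hx) (cosh_pos x)

lemma contDiff_tanh : ContDiff ℝ 1 tanh := by
  have hfun : tanh = fun x ↦ sinh x / cosh x := funext tanh_eq_sinh_div_cosh
  rw [hfun]
  exact contDiff_sinh.div contDiff_cosh fun x ↦ (cosh_pos x).ne'

lemma exp_two_mul_neg_log_cosh (x : ℝ) : exp (2 * -log (cosh x)) = 1 - tanh x ^ 2 := by
  have hc := cosh_pos x
  have h : 2 * -log (cosh x) = -(log (cosh x) + log (cosh x)) := by ring
  rw [h, exp_neg, exp_add, exp_log hc, tanh_eq_sinh_div_cosh]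
  field_simp
  linarith [cosh_sq x]

lemma hasDerivAt_neg_log_cosh {v : ℝ → ℝ} {v' t : ℝ} (hv : HasDerivAt v v' t) :
    HasDerivAt (fun t ↦ -log (cosh (v t))) (-(tanh (v t) * v')) t := by
  refine ((hv.cosh.log (cosh_pos _).ne').neg).congr_deriv ?_
  rw [tanh_eq_sinh_div_cosh]
  ring

/-- for `α ≥ c²/2`, `α > 0`, through every initial datum
`(p̃2*, s2*)` with `s2* < 0` the characteristic system (reduced system with constant
control `a1 ≡ -α`) has a unique solution, and this solution reaches the collision
configuration `(p̃2, s2) = (+∞, 0)` in finite time. -/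
theorem characteristic_system_unique_collision
    (c α : ℝ) (hα1 : c^2 / 2 ≤ α) (hα0 : 0 < α)
    (p0 s0 : ℝ) (hs0 : s0 < 0) :
    ∃ T : ℝ, 0 < T ∧ ∃ p s : ℝ → ℝ,
      p 0 = p0 ∧ s 0 = s0 ∧
      (∀ t ∈ Ico (0:ℝ) T,
        HasDerivAt p ((1/2) * ((p t)^2 - c^2) * Real.exp (2 * s t) + α) t ∧
        HasDerivAt s (p t / 2 * (1 - Real.exp (2 * s t))) t) ∧
      (∀ t ∈ Ico (0:ℝ) T, s t < 0) ∧
      Tendsto s (𝓝[<] T) (𝓝 0) ∧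
      Tendsto p (𝓝[<] T) atTop ∧
      -- uniqueness: any other solution with the same initial data agrees with `(p, s)`
      -- on the common interval of definition
      (∀ (p' s' : ℝ → ℝ) (T' : ℝ),
        p' 0 = p0 → s' 0 = s0 →
        (∀ t ∈ Ico (0:ℝ) T',
          HasDerivAt p' ((1/2) * ((p' t)^2 - c^2) * Real.exp (2 * s' t) + α) t ∧
          HasDerivAt s' (p' t / 2 * (1 - Real.exp (2 * s' t))) t) →
        ∀ t ∈ Ico (0:ℝ) (min T T'), p' t = p t ∧ s' t = s t) := by
  set H : ℝ → ℝ := fun x ↦ tanh x * (α - c ^ 2 / 2 + c ^ 2 / 2 * tanh x ^ 2) with hHdef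
  have hH : ContDiff ℝ 1 H :=
    contDiff_tanh.mul (contDiff_const.add (contDiff_const.mul (contDiff_tanh.pow 2)))
  have hc2 : 0 ≤ c ^ 2 := sq_nonneg c
  have hB : ∀ x, |H x| ≤ α := by
    intro x
    have h1 := abs_tanh_lt_one x
    have h2 := tanh_sq_lt_one x
    have h3 : 0 ≤ α - c ^ 2 / 2 + c ^ 2 / 2 * tanh x ^ 2 :=
      add_nonneg (by linarith) (by positivity)
    rw [hHdef, abs_mul, abs_of_nonneg h3]
    nlinarith
  have hmono : Monotone H := by
    intro x y hxy
    have h1 := tanh_monotone hxy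
    have h2 : tanh x ^ 3 ≤ tanh y ^ 3 := (Odd.strictMono_pow (by decide)).monotone h1
    simp only [hHdef]
    nlinarith
  have hpos : ∀ x, 0 < x → 0 < H x := by
    intro x hx
    have h1 := tanh_pos_of_pos hx
    refine mul_pos h1 ?_
    rcases hc2.eq_or_lt with h | h
    · rw [← h]
      linarith
    · have : 0 < c ^ 2 / 2 * tanh x ^ 2 := by positivity
      linarith
  have hexp : 1 < exp (-s0) := one_lt_exp_iff.2 (by linarith)
  have hv₀ : 0 < arcosh (exp (-s0)) := arcosh_pos hexp
  obtain ⟨T, hT, v, z, hv0, hz0, hsol, hvlim, l, hl, hzlim⟩ :=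
    exists_solution_reaching_zero hH hB hmono hpos hv₀ (p0 * tanh (arcosh (exp (-s0))))
  have htanh_lim : Tendsto (fun t ↦ tanh (v t)) (𝓝[<] T) (𝓝[>] 0) := by
    refine tendsto_nhdsWithin_iff.2 ⟨?_, ?_⟩
    · have := (contDiff_tanh.continuous.tendsto 0).comp hvlim
      rwa [tanh_zero] at this
    · filter_upwards [Ioo_mem_nhdsLT hT] with t ht
        using tanh_pos_of_pos (hsol t ⟨ht.1.le, ht.2⟩).1
  have hps : ∀ t ∈ Ico (0 : ℝ) T,
      HasDerivAt (fun t ↦ z t / tanh (v t)) ((1 / 2) * ((z t / tanh (v t)) ^ 2 - c ^ 2) *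
        exp (2 * -log (cosh (v t))) + α) t ∧
      HasDerivAt (fun t ↦ -log (cosh (v t)))
        (z t / tanh (v t) / 2 * (1 - exp (2 * -log (cosh (v t))))) t := by
    intro t ht
    obtain ⟨hvt, hdv, hdz⟩ := hsol t ht
    have hne : tanh (v t) ≠ 0 := (tanh_pos_of_pos hvt).ne'
    have hdt := (hasDerivAt_tanh (v t)).comp t hdv
    rw [exp_two_mul_neg_log_cosh]
    refine ⟨(hdz.div hdt hne).congr_deriv ?_, (hasDerivAt_neg_log_cosh hdv).congr_deriv ?_⟩
    · simp only [hHdef, Function.comp_apply]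
      field_simp
      ring
    · field_simp
      ring
  have hp0 : z 0 / tanh (v 0) = p0 := by
    rw [hz0, hv0, mul_div_cancel_right₀ _ (tanh_pos_of_pos hv₀).ne']
  have hs0' : -log (cosh (v 0)) = s0 := by
    rw [hv0, cosh_arcosh hexp.le, log_exp, neg_neg]
  refine ⟨T, hT, fun t ↦ z t / tanh (v t), fun t ↦ -log (cosh (v t)), hp0, hs0', hps,
    fun t ht ↦ ?_, ?_, ?_, fun p' s' T' hp' hs' hsol' t ht ↦ ?_⟩
  · exact neg_neg_of_pos (log_pos (one_lt_cosh.2 (hsol t ht).1.ne'))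
  · have h : ContinuousAt (fun x ↦ -log (cosh x)) 0 :=
      (continuous_cosh.continuousAt.log (cosh_pos 0).ne').neg
    have := h.tendsto.comp hvlim
    simpa [Function.comp_def] using this
  · simp only [div_eq_mul_inv]
    exact hzlim.pos_mul_atTop hl (tendsto_inv_nhdsGT_zero.comp htanh_lim)
  · set F : ℝ × ℝ → ℝ × ℝ := fun x ↦
      ((1 / 2) * (x.1 ^ 2 - c ^ 2) * exp (2 * x.2) + α, x.1 / 2 * (1 - exp (2 * x.2)))
    have hF : ContDiff ℝ 1 F := by
      have h1 : ContDiff ℝ 1 fun x : ℝ × ℝ ↦ exp (2 * x.2) :=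
        contDiff_exp.comp (contDiff_const.mul contDiff_snd)
      exact ContDiff.prodMk (((contDiff_const.mul ((contDiff_fst.pow 2).sub contDiff_const)).mul
        h1).add contDiff_const) ((contDiff_fst.div_const 2).mul (contDiff_const.sub h1))
    have h := eq_of_hasDerivAt_Ico_of_contDiff hF (f := fun t ↦ (p' t, s' t))
      (g := fun t ↦ (z t / tanh (v t), -log (cosh (v t)))) (a := 0) (b := min T T')
      (fun u hu ↦ ((hsol' u ⟨hu.1, hu.2.trans_le (min_le_right _ _)⟩).1.prodMk
        (hsol' u ⟨hu.1, hu.2.trans_le (min_le_right _ _)⟩).2))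
      (fun u hu ↦ ((hps u ⟨hu.1, hu.2.trans_le (min_le_left _ _)⟩).1.prodMk
        (hps u ⟨hu.1, hu.2.trans_le (min_le_left _ _)⟩).2))
      (by simp only [hp', hs', hp0, hs0']) t ht
    exact Prod.ext_iff.1 h
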